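/- arXiv:2211.14735 — 2 statements merged into one kernel-verified Lean document; each statement's English description precedes it below -/
import Mathlib

section
/- Let Φ : ℝ → ℝ satisfy Assumption (Φ) with constants m > 1 and K > 1. Then for every n ∈ ℕ there exists a strictly increasing function Φ_n ∈ C^∞(ℝ) with bounded derivatives which satisfies Assumption (Φ) (with the same m) with constant 3K, and such that 𝔞_n(r) := √(Φ_n′(r)) ≥ 2/n for all r ∈ ℝ, and sup_{|r|≤n} |𝔞(r) − 𝔞_n(r)| ≤ 4/n. -/
open MeasureTheory Set Filter Function
open scoped ENNReal Topology RealInnerProductSpace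

noncomputable section

/-- Euclidean space ℝ^d. -/
abbrev Euc (d : ℕ) := EuclideanSpace ℝ (Fin d)

/-- A (space-time) stochastic process `u : Ω_T → (D → ℝ)`. -/
abbrev Proc (d : ℕ) (Ω : Type) := Ω → ℝ → Euc d → ℝ

/-- A random initial datum `ξ : Ω → (D → ℝ)`. -/
abbrev Init (d : ℕ) (Ω : Type) := Ω → Euc d → ℝ

/-- A spatial test function of two variables `g(x,y)`. -/
abbrev TestG (d : ℕ) := Euc d → Euc d → ℝ

/-- `𝔞 = √(Φ′)`. -/
def aFun (Φ : ℝ → ℝ) (r : ℝ) : ℝ := Real.sqrt (deriv Φ r)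

/-- `⟦𝔞⟧(r) = ∫_0^r 𝔞(s) ds`. -/
def AInt (Φ : ℝ → ℝ) (r : ℝ) : ℝ := ∫ s in (0:ℝ)..r, aFun Φ s

/-- Assumption (Φ) of the paper, with constants `m > 1`, `K > 0`. -/
structure AssumptionPhi (m K : ℝ) (Φ : ℝ → ℝ) : Prop where
  m_gt_one : 1 < m
  K_pos : 0 < K
  differentiable : Differentiable ℝ Φ
  strictMono : StrictMono Φ
  map_zero : Φ 0 = 0
  a_zero_le : |aFun Φ 0| ≤ K
  a_diff : ∀ r : ℝ, r ≠ 0 → DifferentiableAt ℝ (aFun Φ) r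
  a_deriv_le : ∀ r : ℝ, r ≠ 0 → |deriv (aFun Φ) r| ≤ K * |r| ^ ((m - 3) / 2)
  a_lower : ∀ r : ℝ, 1 ≤ |r| → K⁻¹ ≤ aFun Φ r
  aInt_lower_out : ∀ r s : ℝ, 1 ≤ max |r| |s| →
    K⁻¹ * |r - s| ≤ |AInt Φ r - AInt Φ s|
  aInt_lower_in : ∀ r s : ℝ, max |r| |s| < 1 →
    K⁻¹ * |r - s| ^ ((m + 1) / 2) ≤ |AInt Φ r - AInt Φ s|

/-- The properties of the approximations `Φ_n` of `Φ` provided by Proposition 4.1: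
`Φ_n` is smooth, strictly increasing, has bounded derivatives, satisfies Assumption (Φ)
with constant `3K`, is non-degenerate (`𝔞_n ≥ 2/n`) and `sup_{|r|≤n}|𝔞 - 𝔞_n| ≤ 4/n`. -/
structure ApproxPhi (m K : ℝ) (Φ : ℝ → ℝ) (n : ℕ) (Φn : ℝ → ℝ) : Prop where
  smooth : ContDiff ℝ (⊤ : ℕ∞) Φn
  derivs_bounded : ∀ k : ℕ, 1 ≤ k → ∃ M : ℝ, ∀ r : ℝ, |iteratedDeriv k Φn r| ≤ M
  assumption : AssumptionPhi m (3 * K) Φn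
  a_lower : ∀ r : ℝ, 2 / (n : ℝ) ≤ aFun Φn r
  a_close : ∀ r : ℝ, |r| ≤ (n : ℝ) → |aFun Φ r - aFun Φn r| ≤ 4 / (n : ℝ)

/-- The fixed one-dimensional mollifier `ρ` of the paper: non-negative, smooth,
supported in `(0,1)`, bounded by `2` and of unit mass. -/
structure IsMollifier (ρ : ℝ → ℝ) : Prop where
  smooth : ContDiff ℝ (⊤ : ℕ∞) ρ
  nonneg : ∀ r, 0 ≤ ρ r
  supp : Function.support ρ ⊆ Ioo 0 1
  le_two : ∀ r, ρ r ≤ 2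
  integral_one : (∫ r, ρ r) = 1

/-- Rescaled mollifier `ρ_δ(r) = δ⁻¹ ρ(δ⁻¹ r)`. -/
def mollAt (ρ : ℝ → ℝ) (δ r : ℝ) : ℝ := δ⁻¹ * ρ (δ⁻¹ * r)

/-- Smooth non-negative? test functions compactly supported in `(0,T)`. -/
def TestT (T : ℝ) : Set (ℝ → ℝ) :=
  {φ | ContDiff ℝ (⊤ : ℕ∞) φ ∧ HasCompactSupport φ ∧ tsupport φ ⊆ Ioo 0 T}

/-- Smooth test functions compactly supported in `[0,T)`. -/
def TestT0 (T : ℝ) : Set (ℝ → ℝ) :=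
  {φ | ContDiff ℝ (⊤ : ℕ∞) φ ∧ HasCompactSupport φ ∧ tsupport φ ⊆ Iio T}

/-- Smooth test functions compactly supported in an open set `D`. -/
def TestD {d : ℕ} (D : Set (Euc d)) : Set (Euc d → ℝ) :=
  {ψ | ContDiff ℝ (⊤ : ℕ∞) ψ ∧ HasCompactSupport ψ ∧ tsupport ψ ⊆ D}

/-- The class `𝓒⁻` : smooth functions with compactly supported derivative,
supported in `(-∞,0]`. -/
def Cneg : Set (ℝ → ℝ) :=
  {h | ContDiff ℝ (⊤ : ℕ∞) h ∧ HasCompactSupport (deriv h) ∧ tsupport h ⊆ Iic 0}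

/-- The class `𝓒⁺` : smooth functions with compactly supported derivative,
supported in `(0,∞)`. -/
def Cpos : Set (ℝ → ℝ) :=
  {h | ContDiff ℝ (⊤ : ℕ∞) h ∧ HasCompactSupport (deriv h) ∧ tsupport h ⊆ Ioi 0}

/-- Partial derivative in the `i`-th coordinate direction. -/
def pd {d : ℕ} (f : Euc d → ℝ) (i : Fin d) (x : Euc d) : ℝ :=
  fderiv ℝ f x (EuclideanSpace.single i (1:ℝ))

/-- Laplacian. -/
def lapl {d : ℕ} (f : Euc d → ℝ) (x : Euc d) : ℝ := ∑ i, pd (pd f i) i x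

/-- `μ = (3m+5)/(4m+4)`, the exponent in the (⋆)-property. -/
def muStar (m : ℝ) : ℝ := (3 * m + 5) / (4 * m + 4)

/-- `R_λ = sup{R ∈ [0,∞] : |𝔞(r) − 𝔞̃(r)| ≤ λ for all |r| < R}`. -/
def Rlam (Φ Φt : ℝ → ℝ) (lam : ℝ) : ℝ≥0∞ :=
  sSup {R : ℝ≥0∞ | ∀ r : ℝ, ENNReal.ofReal |r| < R → |aFun Φ r - aFun Φt r| ≤ lam}

/-- `r ↦ 1_{|r| ≥ R_λ} |1+r|^m`. -/
def cutFun (Φ Φt : ℝ → ℝ) (lam m : ℝ) : ℝ → ℝ :=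
  Set.indicator {s : ℝ | Rlam Φ Φt lam ≤ ENNReal.ofReal |s|} (fun s => |1 + s| ^ m)

/-- The quantity `𝔠(ε,δ,λ,α)` of Lemma 3.7. -/
def Cfrak (m kb beta betat ε δ lam alpha : ℝ) : ℝ :=
  ε ^ (-2:ℝ) * δ ^ (2*beta) + δ ^ beta * ε⁻¹ + ε ^ kb + ε ^ betat
    + ε ^ (1/(m+1)) + ε ^ (2*kb) * δ⁻¹ + ε ^ (-2:ℝ) * δ ^ (2*alpha)
    + ε ^ (-2:ℝ) * lam ^ 2 + ε⁻¹ * lam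

/-- The setting of the paper: a bounded smooth domain `D ⊂ ℝ^d`, a time horizon `T`,
a filtered probability space carrying countably many independent Brownian motions,
coefficients `σ, G, F` with the structural constants `m, K, N₀, κ̄, β, β̃`, the
localization data of Section 3 (finite cover `B_i` of `D̄`, partition of unity `ψ_i`,
shifted mollifiers `ϱ_{ε,i}`, the constant `ε̄`), and the (necessarily abstract)
stochastic-analytic ingredients: Assumptions (C) and (Z) on the coefficients, the
notion of entropy solution (Definition 2.2), of `L₂`-solution (Definition 4.2),
`𝓕₀`-measurability, weak spatial gradients of compositions, the stochastic field
`H_θ` and the error functional `ℰ` of Section 3.1. -/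
structure SPDESetting (d : ℕ) (Ω : Type) [MeasurableSpace Ω] where
  hd : 0 < d
  P : Measure Ω
  hP : IsProbabilityMeasure P
  /-- the bounded domain -/
  D : Set (Euc d)
  hD_open : IsOpen D
  hD_bounded : Bornology.IsBounded D
  hD_conn : IsConnected D
  /-- abstract statement that `∂D` is smooth -/
  smoothBoundary : Prop
  hD_smooth : smoothBoundary
  T : ℝ
  hT : 0 < T
  -- structural constants
  m : ℝ
  K : ℝ
  N₀ : ℝ
  kb : ℝ
  beta : ℝ
  betat : ℝ
  hm : 1 < m
  hK : 0 < K
  hN₀ : 0 < N₀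
  hkb : kb ∈ Set.Ioc (min m 2)⁻¹ 1
  hbeta : beta ∈ Set.Ioc (2 * kb)⁻¹ 1
  hbetat : betat ∈ Set.Ioo 0 1
  -- coefficients
  σ : Fin d → Euc d → ℝ → (ℕ → ℝ)
  G : Fin d → Euc d → ℝ → ℝ
  F : Euc d → ℝ → ℝ
  /-- Assumption 2.3 of the paper on `σ, G, F` (abstract) -/
  AssumptionC : Prop
  /-- the part (2.4)–(2.5) of Assumption 2.3 concerning `σ` only (abstract) -/
  AssumptionCσ : Prop
  hCCσ : AssumptionC → AssumptionCσ
  /-- Assumption 2.5 of the paper: `∇·G(x,0) + F(x,0) ≥ 0`, `∇·σ(x,0) = 0` (abstract) -/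
  AssumptionZ : Prop
  /-- `ξ` is `𝓕₀`-measurable (abstract) -/
  F0meas : Init d Ω → Prop
  /-- `u` is an entropy solution of `Π(Φ, ξ)` in the sense of Definition 2.2 (abstract) -/
  IsEntropySolution : (ℝ → ℝ) → Init d Ω → Proc d Ω → Prop
  /-- `u` is an `L₂`-solution of `Π(Φ, ξ)` in the sense of Definition 4.2 (abstract) -/
  IsL2Solution : (ℝ → ℝ) → Init d Ω → Proc d Ω → Prop
  /-- `gradComp f u = ∇(f(u))`, the weak spatial gradient of `f ∘ u` (abstract) -/
  gradComp : (ℝ → ℝ) → Proc d Ω → Ω → ℝ → Euc d → Euc d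
  -- localization data of Section 3
  Ncov : ℕ
  B : Fin (Ncov + 1) → Set (Euc d)
  psi : Fin (Ncov + 1) → Euc d → ℝ
  /-- the shifted mollifiers `ϱ_{ε,i}` -/
  rho : Fin (Ncov + 1) → ℝ → Euc d → ℝ
  epsBar : ℝ
  hepsBar : 0 < epsBar ∧ epsBar ≤ 1
  hcover : closure D ⊆ ⋃ i, B i
  hB_open : ∀ i, IsOpen (B i)
  hpsi_smooth : ∀ i, ContDiff ℝ (⊤ : ℕ∞) (psi i)
  hpsi_nonneg : ∀ i x, 0 ≤ psi i x
  hpsi_le_one : ∀ i x, psi i x ≤ 1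
  hpsi_supp : ∀ i, tsupport (psi i) ⊆ B i
  hpsi_sum : ∀ x ∈ closure D, (∑ i, psi i x) = 1
  hrho_smooth : ∀ i ε, ContDiff ℝ (⊤ : ℕ∞) (rho i ε)
  hrho_nonneg : ∀ i ε x, 0 ≤ rho i ε x
  hrho_mass : ∀ i, ∀ ε ∈ Set.Ioo (0:ℝ) epsBar, (∫ x, rho i ε x) = 1
  hrho_supp : ∀ i, ∀ x ∈ tsupport (psi i) ∩ closure D, ∀ ε ∈ Set.Ioo (0:ℝ) epsBar,
      (Function.support fun y => rho i ε (x - y)) ⊆ B i ∩ D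
  /-- the stochastic field `H_θ(ω; s, x, z)` of Section 3.1, built from the data
  `(g, φ, u, h)` and `θ` (abstract, stochastic integral) -/
  Hfield : TestG d → (ℝ → ℝ) → Proc d Ω → (ℝ → ℝ) → ℝ →
      Ω → ℝ → Euc d → ℝ → ℝ
  /-- the nine-term error functional `ℰ(u, w, θ)` of Section 3.1, built from the data
  `(g, φ, u, h)` (abstract) -/
  Err : TestG d → (ℝ → ℝ) → Proc d Ω → (ℝ → ℝ) → Proc d Ω → ℝ → ℝ

namespace SPDESetting

variable {d : ℕ} {Ω : Type} [MeasurableSpace Ω]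

/-- The measure `ℙ ⊗ dt ⊗ dx` on `Ω × [0,T] × D`. -/
def μT (S : SPDESetting d Ω) : Measure (Ω × ℝ × Euc d) :=
  S.P.prod ((volume.restrict (Icc 0 S.T)).prod (volume.restrict S.D))

/-- `E ‖u‖_{L_p(D_T)}^p`, as an extended real. -/
def LpNormPow (S : SPDESetting d Ω) (p : ℝ) (u : Proc d Ω) : ℝ≥0∞ :=
  ∫⁻ ω, (∫⁻ t in Icc (0:ℝ) S.T, ∫⁻ x in S.D, ENNReal.ofReal (|u ω t x| ^ p)) ∂S.P

/-- `u ∈ L_p(Ω_T; L_p(D))`. -/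
def MemLp (S : SPDESetting d Ω) (p : ℝ) (u : Proc d Ω) : Prop := S.LpNormPow p u < ⊤

/-- `E ‖ξ‖_{L_p(D)}^p` for an initial datum. -/
def InitLpNormPow (S : SPDESetting d Ω) (p : ℝ) (ξ : Init d Ω) : ℝ≥0∞ :=
  ∫⁻ ω, (∫⁻ x in S.D, ENNReal.ofReal (|ξ ω x| ^ p)) ∂S.P

/-- `ξ ∈ L_p(Ω; L_p(D))`. -/
def InitMemLp (S : SPDESetting d Ω) (p : ℝ) (ξ : Init d Ω) : Prop :=
  S.InitLpNormPow p ξ < ⊤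

/-- `ξ ≥ 0` a.e. -/
def NonnegInit (S : SPDESetting d Ω) (ξ : Init d Ω) : Prop :=
  ∀ᵐ q ∂(S.P.prod (volume.restrict S.D)), 0 ≤ ξ q.1 q.2

/-- `u ≥ 0` for almost all `(ω,t,x) ∈ Ω_T × D`. -/
def NonnegProc (S : SPDESetting d Ω) (u : Proc d Ω) : Prop :=
  ∀ᵐ q ∂S.μT, 0 ≤ u q.1 q.2.1 q.2.2

/-- `u = v` for almost all `(ω,t,x) ∈ Ω_T × D`. -/
def AEeq (S : SPDESetting d Ω) (u v : Proc d Ω) : Prop :=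
  ∀ᵐ q ∂S.μT, u q.1 q.2.1 q.2.2 = v q.1 q.2.1 q.2.2

/-- `E ∫∫ |u - v| dx dt`, the `L₁(Ω × D_T)` distance. -/
def L1dist (S : SPDESetting d Ω) (u v : Proc d Ω) : ℝ≥0∞ :=
  ∫⁻ ω, (∫⁻ t in Icc (0:ℝ) S.T, ∫⁻ x in S.D,
    ENNReal.ofReal |u ω t x - v ω t x|) ∂S.P

/-- `E ‖(u(t,·) - v(t,·))⁺‖_{L₁(D)}` as a function of `t`. -/
def L1posDiff (S : SPDESetting d Ω) (u v : Proc d Ω) (t : ℝ) : ℝ≥0∞ :=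
  ∫⁻ ω, (∫⁻ x in S.D, ENNReal.ofReal (max (u ω t x - v ω t x) 0)) ∂S.P

/-- `E ‖(ξ - ξ')⁺‖_{L₁(D)}`. -/
def L1posDiffInit (S : SPDESetting d Ω) (ξ ξ' : Init d Ω) : ℝ≥0∞ :=
  ∫⁻ ω, (∫⁻ x in S.D, ENNReal.ofReal (max (ξ ω x - ξ' ω x) 0)) ∂S.P

/-- The class `Γ_{B_i}^-` of test functions `g(x,y)`. -/
def GammaNeg (S : SPDESetting d Ω) (i : Fin (S.Ncov + 1)) : Set (TestG d) :=
  {g | ContDiff ℝ (⊤ : ℕ∞) (uncurry g) ∧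
       Function.support (uncurry g) ⊆ (S.B i ∩ closure S.D) ×ˢ (S.B i ∩ closure S.D) ∧
       ∀ x ∈ S.B i ∩ closure S.D, HasCompactSupport (g x) ∧ tsupport (g x) ⊆ S.D}

/-- The class `Γ_{B_i}^+` of test functions `g(x,y)`. -/
def GammaPos (S : SPDESetting d Ω) (i : Fin (S.Ncov + 1)) : Set (TestG d) :=
  {g | ContDiff ℝ (⊤ : ℕ∞) (uncurry g) ∧
       Function.support (uncurry g) ⊆ (S.B i ∩ closure S.D) ×ˢ (S.B i ∩ closure S.D) ∧
       ∀ y ∈ S.B i ∩ closure S.D,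
         HasCompactSupport (fun x => g x y) ∧ tsupport (fun x => g x y) ⊆ S.D}

/-- `E ∫_0^T ∫_D H_θ(s, x, w(s,x)) dx ds`. -/
def EH (S : SPDESetting d Ω) (g : TestG d) (φ : ℝ → ℝ) (u : Proc d Ω) (h : ℝ → ℝ)
    (θ : ℝ) (w : Proc d Ω) : ℝ :=
  ∫ ω, (∫ s in Icc (0:ℝ) S.T, ∫ x in S.D, S.Hfield g φ u h θ ω s x (w ω s x)) ∂S.P

/-- `H_θ(·, ·, w(·,·)) ∈ L₁(Ω_T × D)`. -/
def HInt (S : SPDESetting d Ω) (g : TestG d) (φ : ℝ → ℝ) (u : Proc d Ω) (h : ℝ → ℝ)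
    (θ : ℝ) (w : Proc d Ω) : Prop :=
  Integrable (fun q : Ω × ℝ × Euc d =>
    S.Hfield g φ u h θ q.1 q.2.1 q.2.2 (w q.1 q.2.1 q.2.2)) S.μT

/-- The inequality of Definition 3.3, for a given constant `C` and parameter `θ`. -/
def StarIneq (S : SPDESetting d Ω) (g : TestG d) (φ : ℝ → ℝ) (u : Proc d Ω)
    (h : ℝ → ℝ) (w : Proc d Ω) (C θ : ℝ) : Prop :=
  S.HInt g φ u h θ w ∧
    S.EH g φ u h θ w ≤ C * θ ^ (1 - muStar S.m) + S.Err g φ u h w θ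

/-- Definition 3.3: the (⋆)-property. -/
def HasStar (S : SPDESetting d Ω) (w : Proc d Ω) : Prop :=
  (∀ i : Fin (S.Ncov + 1), ∀ g ∈ S.GammaNeg i, ∀ φ ∈ TestT S.T,
     ∀ u : Proc d Ω, S.MemLp (S.m + 1) u → S.NonnegProc u → ∀ h ∈ Cneg,
       ∃ C : ℝ, ∃ θ₀ > (0:ℝ), ∀ θ ∈ Ioo (0:ℝ) (min θ₀ 1),
         S.StarIneq g φ u h w C θ) ∧
  (∀ i : Fin (S.Ncov + 1), ∀ g ∈ S.GammaPos i, ∀ φ ∈ TestT S.T,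
     ∀ u : Proc d Ω, S.MemLp (S.m + 1) u → ∀ h ∈ Cpos,
       ∃ C : ℝ, ∃ θ₀ > (0:ℝ), ∀ θ ∈ Ioo (0:ℝ) (min θ₀ 1),
         S.StarIneq g φ u h w C θ)

/-- `∂_z H_θ`. -/
def dzH (S : SPDESetting d Ω) (g : TestG d) (φ : ℝ → ℝ) (u : Proc d Ω) (h : ℝ → ℝ)
    (θ : ℝ) (ω : Ω) (s : ℝ) (x : Euc d) (z : ℝ) : ℝ :=
  deriv (fun z' => S.Hfield g φ u h θ ω s x z') z

/-- `‖∂_z H_θ(ω; s, ·, ·)‖_{H^k_{m+1}(D × ℝ)}^{m+1}`, via iterated derivatives. -/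
def sobPow (S : SPDESetting d Ω) (g : TestG d) (φ : ℝ → ℝ) (u : Proc d Ω) (h : ℝ → ℝ)
    (θ : ℝ) (k : ℕ) (ω : Ω) (s : ℝ) : ℝ≥0∞ :=
  ∑ n ∈ Finset.range (k + 1),
    ∫⁻ q in S.D ×ˢ (univ : Set ℝ),
      ENNReal.ofReal
        (‖iteratedFDeriv ℝ n (fun q' : Euc d × ℝ => S.dzH g φ u h θ ω s q'.1 q'.2) q‖
          ^ (S.m + 1))

/-- `𝒩_m(u) = E ∫_0^T (1 + ‖u(t)‖_{L_{(m+1)/2}}^{m+1} + ‖u(t)‖_{L₂}^{m+1}) dt`. -/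
def calN (S : SPDESetting d Ω) (u : Proc d Ω) : ℝ≥0∞ :=
  ∫⁻ ω, (∫⁻ t in Icc (0:ℝ) S.T,
    (1 + (∫⁻ x in S.D, ENNReal.ofReal (|u ω t x| ^ ((S.m + 1) / 2))) ^ (2:ℝ)
       + (∫⁻ x in S.D, ENNReal.ofReal (|u ω t x| ^ (2:ℝ))) ^ ((S.m + 1) / 2))) ∂S.P

/-- `sup_{|h| ≤ 2ε} E ‖ξ(·) − ξ̄(· + h)‖_{L₁(D)}`, where `ξ̄` is the extension of `ξ`
by zero outside `D`. -/
def shiftSup (S : SPDESetting d Ω) (ξ : Init d Ω) (ε : ℝ) : ℝ :=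
  sSup {a : ℝ | ∃ v : Euc d, ‖v‖ ≤ 2 * ε ∧
    a = ∫ ω, (∫ x in S.D, |ξ ω x - S.D.indicator (ξ ω) (x + v)|) ∂S.P}

end SPDESetting

open scoped NNReal in
lemma napx_moll (f : ℝ → ℝ) (C : ℝ≥0) (hf : LipschitzWith C f) (δ : ℝ) (hδ : 0 < δ) :
    ∃ g : ℝ → ℝ, ContDiff ℝ (⊤ : ℕ∞) g ∧ LipschitzWith C g ∧ (∀ x, |g x - f x| ≤ C * δ) ∧
      (∀ x, (∀ y, |y - x| < δ → f y = f x) → g x = f x) := by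
  let φ : ContDiffBump (0:ℝ) := ⟨δ/2, δ, by positivity, by linarith⟩
  have hli : LocallyIntegrable f volume := hf.continuous.locallyIntegrable
  have hex := φ.hasCompactSupport_normed (μ := volume).convolutionExists_left
    (ContinuousLinearMap.lsmul ℝ ℝ) φ.continuous_normed hli
  refine ⟨convolution (φ.normed volume) f (ContinuousLinearMap.lsmul ℝ ℝ) volume, ?_, ?_, ?_, ?_⟩
  · exact φ.hasCompactSupport_normed.contDiff_convolution_left _ φ.contDiff_normed hli
  · refine LipschitzWith.of_dist_le_mul fun x y => ?_
    rw [dist_eq_norm, convolution_def, convolution_def, ← integral_sub (hex x) (hex y)]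
    have h1 : ∀ t, ‖(ContinuousLinearMap.lsmul ℝ ℝ (φ.normed volume t)) (f (x - t)) -
        (ContinuousLinearMap.lsmul ℝ ℝ (φ.normed volume t)) (f (y - t))‖ ≤
        φ.normed volume t * (C * dist x y) := by
      intro t
      rw [← map_sub, ContinuousLinearMap.lsmul_apply, norm_smul, Real.norm_of_nonneg
        (φ.nonneg_normed t), ← dist_eq_norm]
      refine mul_le_mul_of_nonneg_left ?_ (φ.nonneg_normed t)
      have := hf.dist_le_mul (x - t) (y - t)
      simpa using this
    refine (norm_integral_le_of_norm_le ?_ (Eventually.of_forall h1)).trans ?_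
    · exact φ.integrable_normed.mul_const _
    · rw [integral_mul_const, φ.integral_normed, one_mul]
  · intro x
    have := φ.dist_normed_convolution_le (μ := volume) (g := f) (x₀ := x) (ε := C * δ)
      hf.continuous.aestronglyMeasurable (fun y hy => by
        refine (hf.dist_le_mul y x).trans ?_
        exact mul_le_mul_of_nonneg_left (Metric.mem_ball.1 hy).le C.2)
    rwa [Real.dist_eq] at this
  · intro x hx
    exact φ.normed_convolution_eq_right (μ := volume) fun y hy => hx y (by
      simpa [Real.dist_eq, φ] using hy)

lemma napx_right (p K : ℝ) (hp : 0 < p) (hK : 0 < K) (Φ : ℝ → ℝ) (hd : Differentiable ℝ Φ)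
    (hmono : Monotone Φ) (ha : ∀ r, 0 < r → DifferentiableAt ℝ (aFun Φ) r)
    (hb : ∀ r, 0 < r → |deriv (aFun Φ) r| ≤ K * r ^ (p - 1)) :
    ∃ G : ℝ → ℝ, LipschitzWith (K / p).toNNReal G ∧ ∀ r, 0 ≤ r → aFun Φ r = G (r ^ p) := by
  have hder : ∀ x : ℝ, 0 < x → HasDerivAt (fun x : ℝ => K / p * x ^ p) (K * x ^ (p - 1)) x := by
    intro x hx
    have := (Real.hasDerivAt_rpow_const (p := p) (Or.inl hx.ne')).const_mul (K / p)
    rwa [← mul_assoc, div_mul_cancel₀ _ hp.ne'] at this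
  have hm1 : MonotoneOn (fun x => K / p * x ^ p + aFun Φ x) (Ioi 0) := by
    refine monotoneOn_of_deriv_nonneg (convex_Ioi 0) ?_ ?_ ?_
    · exact fun x hx => ((hder x hx).continuousAt.add (ha x hx).continuousAt).continuousWithinAt
    · rw [interior_Ioi]
      exact fun x hx => ((hder x hx).differentiableAt.add (ha x hx)).differentiableWithinAt
    · rw [interior_Ioi]
      intro x hx
      have := ((hder x hx).add (ha x hx).hasDerivAt).deriv
      have h2 : deriv (fun x => K / p * x ^ p + aFun Φ x) x = K * x ^ (p - 1) + deriv (aFun Φ) x :=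
        this
      rw [h2]
      have := abs_le.1 (hb x hx)
      linarith [this.1]
  have hm2 : MonotoneOn (fun x => K / p * x ^ p - aFun Φ x) (Ioi 0) := by
    refine monotoneOn_of_deriv_nonneg (convex_Ioi 0) ?_ ?_ ?_
    · exact fun x hx => ((hder x hx).continuousAt.sub (ha x hx).continuousAt).continuousWithinAt
    · rw [interior_Ioi]
      exact fun x hx => ((hder x hx).differentiableAt.sub (ha x hx)).differentiableWithinAt
    · rw [interior_Ioi]
      intro x hx
      have := ((hder x hx).sub (ha x hx).hasDerivAt).deriv
      have h2 : deriv (fun x => K / p * x ^ p - aFun Φ x) x = K * x ^ (p - 1) - deriv (aFun Φ) x :=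
        this
      rw [h2]
      have := abs_le.1 (hb x hx)
      linarith [this.2]
  have key : ∀ s r : ℝ, 0 < s → s ≤ r → |aFun Φ r - aFun Φ s| ≤ K / p * (r ^ p - s ^ p) := by
    intro s r hs hsr
    have h1 := hm1 (mem_Ioi.2 hs) (mem_Ioi.2 (hs.trans_le hsr)) hsr
    have h2 := hm2 (mem_Ioi.2 hs) (mem_Ioi.2 (hs.trans_le hsr)) hsr
    simp only at h1 h2
    rw [abs_le]; constructor <;> linarith
  have hinv : ∀ v : ℝ, 0 < v → (v ^ (1 / p)) ^ p = v := by
    intro v hv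
    rw [← Real.rpow_mul hv.le, one_div, inv_mul_cancel₀ hp.ne', Real.rpow_one]
  have hinv' : ∀ v : ℝ, 0 ≤ v → (v ^ p) ^ (1 / p) = v := by
    intro v hv
    rw [← Real.rpow_mul hv, one_div, mul_inv_cancel₀ hp.ne', Real.rpow_one]
  have hlip : LipschitzOnWith (K / p).toNNReal (fun v => aFun Φ (v ^ (1 / p))) (Ioi 0) := by
    have aux : ∀ x y : ℝ, 0 < x → x ≤ y →
        |aFun Φ (y ^ (1 / p)) - aFun Φ (x ^ (1 / p))| ≤ K / p * (y - x) := by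
      intro x y hx hxy
      have := key (x ^ (1 / p)) (y ^ (1 / p)) (Real.rpow_pos_of_pos hx _)
        (Real.rpow_le_rpow hx.le hxy (by positivity))
      rwa [hinv x hx, hinv y (hx.trans_le hxy)] at this
    refine LipschitzOnWith.of_dist_le_mul fun x hx y hy => ?_
    rw [Real.coe_toNNReal _ (by positivity), Real.dist_eq, Real.dist_eq]
    rcases le_total x y with h | h
    · rw [abs_sub_comm, abs_sub_comm x y, abs_of_nonneg (sub_nonneg.2 h)]
      exact aux x y hx h
    · rw [abs_of_nonneg (sub_nonneg.2 h)]
      exact aux y x hy h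
  obtain ⟨G, hG, hGe⟩ := hlip.extend_real
  have hpos : ∀ r, 0 < r → aFun Φ r = G (r ^ p) := by
    intro r hr
    rw [← hGe (mem_Ioi.2 (Real.rpow_pos_of_pos hr p))]
    simp only
    rw [hinv' r hr.le]
  refine ⟨G, hG, fun r hr => ?_⟩
  rcases hr.eq_or_lt with rfl | hr
  swap
  · exact hpos r hr
  have hdn : ∀ x, 0 ≤ deriv Φ x := fun x => hmono.deriv_nonneg
  have hcont : Continuous fun r : ℝ => G (r ^ p) :=
    hG.continuous.comp (Real.continuous_rpow_const hp.le)
  have hlim : Tendsto (fun r : ℝ => G (r ^ p)) (𝓝[>] 0) (𝓝 (G (0 ^ p))) :=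
    (hcont.tendsto 0).mono_left nhdsWithin_le_nhds
  have hG0 : 0 ≤ G (0 ^ p) := by
    refine ge_of_tendsto hlim ?_
    filter_upwards [self_mem_nhdsWithin] with r hr
    rw [← hpos r hr]
    exact Real.sqrt_nonneg _
  have hlim2 : Tendsto (fun r => deriv Φ r) (𝓝[>] 0) (𝓝 (G (0 ^ p) ^ 2)) := by
    refine (hlim.pow 2).congr' ?_
    filter_upwards [self_mem_nhdsWithin] with r hr
    rw [← hpos r hr, aFun, Real.sq_sqrt (hdn r)]
  have h1 := hasDerivWithinAt_Ici_of_tendsto_deriv (s := Ioi 0) hd.differentiableOn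
    hd.continuous.continuousWithinAt self_mem_nhdsWithin hlim2
  have h2 := (hd 0).hasDerivAt.hasDerivWithinAt (s := Ici 0)
  have h3 := (uniqueDiffOn_Ici (0:ℝ) 0 self_mem_Ici).eq_deriv _ h1 h2
  rw [aFun, ← h3, Real.sqrt_sq hG0]

def napxV (p r : ℝ) : ℝ := if 0 ≤ r then r ^ p else -(-r) ^ p

lemma napxV_nonneg (p r : ℝ) (hr : 0 ≤ r) : napxV p r = r ^ p := by simp [napxV, hr]

lemma napxV_neg (p r : ℝ) (hp : 0 < p) (hr : 0 ≤ r) : napxV p (-r) = -r ^ p := by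
  rcases hr.eq_or_lt with rfl | hr
  · simp [napxV, hp.ne']
  · simp [napxV, hr.not_ge]

lemma napxV_abs (p r : ℝ) : |napxV p r| = |r| ^ p := by
  unfold napxV
  split_ifs with h
  · rw [abs_of_nonneg h, abs_of_nonneg (Real.rpow_nonneg h _)]
  · push Not at h
    rw [abs_neg, abs_of_neg h, abs_of_nonneg (Real.rpow_nonneg (by linarith) _)]

lemma napxV_smooth (p r : ℝ) (hr : r ≠ 0) :
    ContDiffAt ℝ (⊤ : ℕ∞) (napxV p) r ∧ HasDerivAt (napxV p) (p * |r| ^ (p - 1)) r := by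
  rcases lt_or_gt_of_ne hr with h | h
  · have he : napxV p =ᶠ[𝓝 r] fun x => -(-x) ^ p := by
      filter_upwards [Iio_mem_nhds h] with x hx
      simp [napxV, not_le.2 (mem_Iio.1 hx)]
    constructor
    · refine ContDiffAt.congr_of_eventuallyEq ?_ he
      exact (contDiffAt_id.neg.rpow_const_of_ne (by simpa using hr)).neg
    · refine HasDerivAt.congr_of_eventuallyEq ?_ he
      have h1 : HasDerivAt (fun x : ℝ => -x) (-1) r := (hasDerivAt_id r).neg
      have h2 := (h1.rpow_const (p := p) (Or.inl (by simpa using hr))).neg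
      rw [abs_of_neg h]
      have h3 : -(-1 * p * (-r) ^ (p - 1)) = p * (-r) ^ (p - 1) := by ring
      rw [h3] at h2
      exact h2
  · have he : napxV p =ᶠ[𝓝 r] fun x => x ^ p := by
      filter_upwards [Ioi_mem_nhds h] with x hx
      simp [napxV, (mem_Ioi.1 hx).le]
    constructor
    · refine ContDiffAt.congr_of_eventuallyEq ?_ he
      exact (contDiffAt_id.rpow_const_of_ne hr)
    · refine HasDerivAt.congr_of_eventuallyEq ?_ he
      have := (Real.hasDerivAt_rpow_const (p := p) (Or.inl hr))
      rwa [abs_of_pos h]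

lemma napx_clamp (R δ v : ℝ) (hR : 0 ≤ R) (hδ : 0 ≤ δ) (hv : 0 ≤ v) :
    |max 0 (min R (v - δ)) - min R v| ≤ δ := by
  rw [abs_le]
  rcases le_total R v with h1 | h1 <;> rcases le_total R (v - δ) with h2 | h2 <;>
    rcases le_total 0 (v - δ) with h3 | h3 <;>
    simp [h1, h2, h3, hR] <;> (try constructor) <;> linarith

lemma napx_approx (p K : ℝ) (hp : 0 < p) (hK : 0 < K) (a GR HL : ℝ → ℝ)
    (hR : LipschitzWith (K / p).toNNReal GR) (hL : LipschitzWith (K / p).toNNReal HL)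
    (haR : ∀ r, 0 ≤ r → a r = GR (r ^ p)) (haL : ∀ r, 0 ≤ r → a (-r) = HL (r ^ p))
    (N ε : ℝ) (hN : 0 < N) (hε : 0 < ε) :
    ∃ g : ℝ → ℝ, ContDiff ℝ (⊤ : ℕ∞) g ∧ HasCompactSupport (deriv g) ∧
      (∀ r, r ≠ 0 → |deriv g r| ≤ 3 * K * |r| ^ (p - 1)) ∧
      (∀ r, 0 ≤ r → |g r - a (min N r)| ≤ ε) ∧
      (∀ r, 0 ≤ r → |g (-r) - a (-(min N r))| ≤ ε) := by
  set C : ℝ := K / p with hC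
  have hC0 : 0 < C := by positivity
  set δ : ℝ := ε / (3 * C) with hδd
  have hδ : 0 < δ := by positivity
  have hCδ : 3 * C * δ = ε := by rw [hδd]; field_simp
  set R : ℝ := N ^ p with hRd
  have hR0 : 0 < R := by positivity
  have hGR0 : GR 0 = a 0 := by rw [haR 0 le_rfl, Real.zero_rpow hp.ne']
  have hHL0 : HL 0 = a 0 := by
    have := haL 0 le_rfl
    rw [Real.zero_rpow hp.ne', neg_zero] at this
    exact this.symm
  have hcl : LipschitzWith 1 fun x : ℝ => max 0 (min R x) :=
    (LipschitzWith.id.const_min R).const_max 0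
  have hs1 : LipschitzWith 1 fun v : ℝ => v - δ :=
    LipschitzWith.of_dist_le_mul fun x y => by simp
  have hs2 : LipschitzWith 1 fun v : ℝ => -v - δ :=
    LipschitzWith.of_dist_le_mul fun x y => by simp
  let f : ℝ → ℝ := fun v => GR (max 0 (min R (v - δ))) + HL (max 0 (min R (-v - δ))) - a 0
  have hf : LipschitzWith (C.toNNReal + C.toNNReal) f := by
    have h1 := hR.comp (hcl.comp hs1)
    have h2 := hL.comp (hcl.comp hs2)
    have h3 := (h1.add h2).add (LipschitzWith.const (-a 0))
    simpa [f, sub_eq_add_neg, Function.comp_def] using h3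
  have hfp : ∀ v, 0 ≤ v → f v = GR (max 0 (min R (v - δ))) := by
    intro v hv
    have : max 0 (min R (-v - δ)) = 0 := max_eq_left ((min_le_right _ _).trans (by linarith))
    simp only [f, this, hHL0]; ring
  have hfn : ∀ v, 0 ≤ v → f (-v) = HL (max 0 (min R (v - δ))) := by
    intro v hv
    have : max 0 (min R (-v - δ)) = 0 := max_eq_left ((min_le_right _ _).trans (by linarith))
    simp only [f, this, hGR0, neg_neg]; ring
  have hfzero : ∀ v, |v| ≤ δ → f v = a 0 := by
    intro v hv
    have hv := abs_le.1 hv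
    have h1 : max 0 (min R (-v - δ)) = 0 := max_eq_left ((min_le_right _ _).trans (by linarith))
    have h2 : max 0 (min R (v - δ)) = 0 := max_eq_left ((min_le_right _ _).trans (by linarith))
    simp only [f, h1, h2, hGR0, hHL0]; ring
  have hfbig : ∀ v, R + δ ≤ v → f v = GR R := by
    intro v hv
    rw [hfp v (by linarith), min_eq_left (by linarith), max_eq_right hR0.le]
  have hfsmall : ∀ v, R + δ ≤ -v → f v = HL R := by
    intro v hv
    have := hfn (-v) (by linarith)
    rw [neg_neg] at this
    rw [this, min_eq_left (by linarith), max_eq_right hR0.le]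
  obtain ⟨G, hGs, hGl, hGa, hGc⟩ := napx_moll f _ hf (δ / 2) (by positivity)
  have hcoe : ((C.toNNReal + C.toNNReal : NNReal) : ℝ) = 2 * C := by
    rw [NNReal.coe_add, Real.coe_toNNReal _ hC0.le]; ring
  rw [hcoe] at hGa
  have hGzero : ∀ v, |v| < δ / 2 → G v = a 0 := by
    intro v hv
    rw [hGc v, hfzero v (by linarith)]
    intro y hy
    rw [hfzero v (by linarith), hfzero y]
    have := abs_add_le (y - v) v
    rw [sub_add_cancel] at this
    linarith
  have hGbig : ∀ v, R + 2 * δ < v → G v = GR R := by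
    intro v hv
    rw [hGc v, hfbig v (by linarith)]
    intro y hy
    rw [hfbig v (by linarith), hfbig y]
    linarith [(abs_lt.1 hy).1]
  have hGsmall : ∀ v, R + 2 * δ < -v → G v = HL R := by
    intro v hv
    rw [hGc v, hfsmall v (by linarith)]
    intro y hy
    rw [hfsmall v (by linarith), hfsmall y]
    linarith [(abs_lt.1 hy).2]
  have hmin : ∀ r, 0 ≤ r → (min N r) ^ p = min R (r ^ p) := by
    intro r hr
    rcases le_total N r with h | h
    · rw [min_eq_left h, min_eq_left (Real.rpow_le_rpow hN.le h hp.le)]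
    · rw [min_eq_right h, min_eq_right (Real.rpow_le_rpow hr h hp.le)]
  have hGd : Differentiable ℝ G := hGs.differentiable (by simp)
  refine ⟨fun r => G (napxV p r), ?_, ?_, ?_, ?_, ?_⟩
  · rw [contDiff_iff_contDiffAt]
    intro r
    by_cases hr : r = 0
    · have hc : Continuous fun x : ℝ => |x| ^ p :=
        (Real.continuous_rpow_const hp.le).comp continuous_abs
      have hev : ∀ᶠ x in 𝓝 r, |x| ^ p < δ / 2 := by
        refine hc.continuousAt.eventually_lt continuousAt_const ?_
        rw [hr, abs_zero, Real.zero_rpow hp.ne']; positivity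
      refine ContDiffAt.congr_of_eventuallyEq (contDiffAt_const (c := a 0)) ?_
      filter_upwards [hev] with x hx
      exact hGzero _ (by rwa [napxV_abs])
    · exact hGs.contDiffAt.comp r (napxV_smooth p r hr).1
  · set M : ℝ := (R + 2 * δ) ^ (1 / p) with hM
    have hM0 : 0 ≤ M := by positivity
    have hMp : M ^ p = R + 2 * δ := by
      rw [hM, ← Real.rpow_mul (by positivity), one_div, inv_mul_cancel₀ hp.ne', Real.rpow_one]
    refine HasCompactSupport.intro (isCompact_Icc (a := -M) (b := M)) ?_
    intro x hx
    rw [mem_Icc, not_and_or, not_le, not_le] at hx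
    rcases hx with hx | hx
    · have : (fun r => G (napxV p r)) =ᶠ[𝓝 x] fun _ => HL R := by
        filter_upwards [Iio_mem_nhds hx] with y hy
        have hy : y < -M := hy
        apply hGsmall
        have := napxV_neg p (-y) hp (by linarith)
        rw [neg_neg] at this
        rw [this, neg_neg, ← hMp]
        exact Real.rpow_lt_rpow hM0 (by linarith) hp
      rw [this.deriv_eq, deriv_const]
    · have : (fun r => G (napxV p r)) =ᶠ[𝓝 x] fun _ => GR R := by
        filter_upwards [Ioi_mem_nhds hx] with y hy
        have hy : M < y := hy
        apply hGbig
        rw [napxV_nonneg p y (by linarith), ← hMp]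
        exact Real.rpow_lt_rpow hM0 (by linarith) hp
      rw [this.deriv_eq, deriv_const]
  · intro r hr
    have h1 := ((hGd (napxV p r)).hasDerivAt.comp r (napxV_smooth p r hr).2).deriv
    have h2 : deriv (fun r => G (napxV p r)) r = deriv G (napxV p r) * (p * |r| ^ (p - 1)) := h1
    have h3 := norm_deriv_le_of_lipschitz hGl (x₀ := napxV p r)
    rw [hcoe, Real.norm_eq_abs] at h3
    have hw : 0 ≤ |r| ^ (p - 1) := by positivity
    rw [h2, abs_mul, abs_of_nonneg (mul_nonneg hp.le hw)]
    calc _ ≤ (2 * C) * (p * |r| ^ (p - 1)) :=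
          mul_le_mul_of_nonneg_right h3 (mul_nonneg hp.le hw)
      _ = 2 * K * |r| ^ (p - 1) := by rw [hC]; field_simp
      _ ≤ _ := by nlinarith
  · intro r hr
    have hv : 0 ≤ r ^ p := Real.rpow_nonneg hr _
    simp only
    rw [napxV_nonneg p r hr, haR _ (le_min hN.le hr), hmin r hr]
    have h1 := hGa (r ^ p)
    have h2 := hR.dist_le_mul (max 0 (min R (r ^ p - δ))) (min R (r ^ p))
    rw [← hfp _ hv, Real.dist_eq, Real.dist_eq, Real.coe_toNNReal _ hC0.le] at h2
    have h3 := mul_le_mul_of_nonneg_left (napx_clamp R δ _ hR0.le hδ.le hv) hC0.le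
    have h4 := abs_sub_le (G (r ^ p)) (f (r ^ p)) (GR (min R (r ^ p)))
    nlinarith [mul_pos hC0 hδ]
  · intro r hr
    have hv : 0 ≤ r ^ p := Real.rpow_nonneg hr _
    simp only
    rw [napxV_neg p r hp hr, haL _ (le_min hN.le hr), hmin r hr]
    have h1 := hGa (-r ^ p)
    have h2 := hL.dist_le_mul (max 0 (min R (r ^ p - δ))) (min R (r ^ p))
    rw [← hfn _ hv, Real.dist_eq, Real.dist_eq, Real.coe_toNNReal _ hC0.le] at h2
    have h3 := mul_le_mul_of_nonneg_left (napx_clamp R δ _ hR0.le hδ.le hv) hC0.le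
    have h4 := abs_sub_le (G (-r ^ p)) (f (-r ^ p)) (HL (min R (r ^ p)))
    nlinarith [mul_pos hC0 hδ]

lemma napx_bdd (i : ℕ) : ∀ q : ℝ → ℝ, ContDiff ℝ (⊤ : ℕ∞) q → HasCompactSupport q →
    ∃ M : ℝ, ∀ r, |iteratedDeriv i q r| ≤ M := by
  induction i with
  | zero =>
    intro q hq hc
    simpa using hc.exists_bound_of_continuous hq.continuous
  | succ i ih =>
    intro q hq hc
    rw [iteratedDeriv_succ']
    exact ih _ (contDiff_infty_iff_deriv.1 hq).2 hc.deriv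

lemma napx_cont (p : ℝ) (hp : 0 < p) (a GR HL : ℝ → ℝ) (hR : Continuous GR) (hL : Continuous HL)
    (haR : ∀ r, 0 ≤ r → a r = GR (r ^ p)) (haL : ∀ r, 0 ≤ r → a (-r) = HL (r ^ p)) :
    Continuous a := by
  have hGR0 : GR 0 = a 0 := by rw [haR 0 le_rfl, Real.zero_rpow hp.ne']
  have hHL0 : HL 0 = a 0 := by
    have := haL 0 le_rfl
    rw [Real.zero_rpow hp.ne', neg_zero] at this
    exact this.symm
  have he : a = fun r => GR ((max r 0) ^ p) + HL ((max (-r) 0) ^ p) - a 0 := by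
    funext r
    rcases le_total 0 r with h | h
    · rw [max_eq_left h, max_eq_right (by linarith), Real.zero_rpow hp.ne', hHL0, ← haR r h]; ring
    · rw [max_eq_right h, max_eq_left (by linarith), Real.zero_rpow hp.ne', hGR0,
        ← haL (-r) (by linarith), neg_neg]; ring
  have hc : Continuous fun x : ℝ => x ^ p := Real.continuous_rpow_const hp.le
  rw [he]
  exact ((hR.comp (hc.comp (continuous_id.max continuous_const))).add
    (hL.comp (hc.comp (continuous_neg.max continuous_const)))).sub continuous_const

lemma napx_main (m K : ℝ) (Φ : ℝ → ℝ) (hK : 1 < K) (hΦ : AssumptionPhi m K Φ)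
    (n : ℕ) (hn : 0 < n) : ∃ Φn : ℝ → ℝ, ApproxPhi m K Φ n Φn := by
  have hm := hΦ.m_gt_one
  obtain ⟨p, hpd⟩ : ∃ p : ℝ, p = (m - 1) / 2 := ⟨_, rfl⟩
  have hp : 0 < p := by rw [hpd]; linarith
  have hp1 : (m - 3) / 2 = p - 1 := by rw [hpd]; ring
  have hK0 : 0 < K := by linarith
  have hn1 : (1:ℝ) ≤ n := by exact_mod_cast hn
  have hN : (0:ℝ) < n := by linarith
  have hbd := hΦ.a_deriv_le
  rw [hp1] at hbd
  obtain ⟨GR, hGR, haR⟩ := napx_right p K hp hK0 Φ hΦ.differentiable hΦ.strictMono.monotone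
    (fun r hr => hΦ.a_diff r hr.ne') (fun r hr => by
      have := hbd r hr.ne'
      rwa [abs_of_pos hr] at this)
  have hrefl : aFun (fun r => -Φ (-r)) = fun r => aFun Φ (-r) := by
    funext r
    have h1 : HasDerivAt (fun r => -Φ (-r)) (deriv Φ (-r)) r := by
      have h2 : HasDerivAt (fun r => Φ (-r)) (deriv Φ (-r) * -1) r :=
        HasDerivAt.comp r (hΦ.differentiable (-r)).hasDerivAt (hasDerivAt_neg r)
      have h3 := h2.neg
      rw [mul_neg_one, neg_neg] at h3
      exact h3
    rw [aFun, h1.deriv, aFun]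
  obtain ⟨HL, hHL, haL⟩ := napx_right p K hp hK0 (fun r => -Φ (-r))
    ((hΦ.differentiable.comp differentiable_neg).neg)
    (fun x y hxy => neg_le_neg (hΦ.strictMono.monotone (neg_le_neg hxy)))
    (fun r hr => by
      rw [hrefl]
      exact (hΦ.a_diff (-r) (by linarith)).comp r differentiable_neg.differentiableAt)
    (fun r hr => by
      have h0 : -r ≠ 0 := by linarith
      rw [hrefl, deriv_comp_neg, abs_neg]
      have := hbd (-r) h0
      rwa [abs_neg, abs_of_pos hr] at this)
  rw [hrefl] at haL
  have hac : Continuous (aFun Φ) := napx_cont p hp _ GR HL hGR.continuous hHL.continuous haR haL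
  have ha0 : ∀ r, 0 ≤ aFun Φ r := fun r => Real.sqrt_nonneg _
  obtain ⟨ε, hε, hε1, hε2⟩ : ∃ ε : ℝ, 0 < ε ∧ ε ≤ 1 / n ∧ ε ≤ (K - 1) :=
    ⟨min (1 / n) (K - 1), lt_min (by positivity) (by linarith), min_le_left _ _, min_le_right _ _⟩
  obtain ⟨g, hgs, hgc, hgd, hgp, hgn⟩ := napx_approx p K hp hK0 (aFun Φ) GR HL hGR hHL haR haL
    n ε hN hε
  have h2n : 0 < 2 / (n:ℝ) := by positivity
  have h2n' : 2 / (n:ℝ) ≤ 2 := by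
    rw [div_le_iff₀ hN]; linarith
  have h12 : 1 / (n:ℝ) + 1 / n = 2 / n := by ring
  have h24 : 2 / (n:ℝ) + 2 / n = 4 / n := by ring
  -- clamped comparison
  have hcmp : ∀ r : ℝ, ∃ x : ℝ, |x| ≤ n ∧ (|r| ≤ n → x = r) ∧ (1 ≤ |r| → 1 ≤ |x|) ∧
      |g r - aFun Φ x| ≤ ε := by
    intro r
    rcases le_total 0 r with h | h
    · have hx0 : 0 ≤ min (n:ℝ) r := le_min hN.le h
      refine ⟨min n r, ?_, ?_, ?_, hgp r h⟩
      · rw [abs_of_nonneg hx0]; exact min_le_left _ _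
      · rw [abs_of_nonneg h]; exact min_eq_right
      · rw [abs_of_nonneg h, abs_of_nonneg hx0]; exact le_min hn1
    · have h' : 0 ≤ -r := by linarith
      have hx0 : 0 ≤ min (n:ℝ) (-r) := le_min hN.le h'
      refine ⟨-min (n:ℝ) (-r), ?_, ?_, ?_, ?_⟩
      · rw [abs_neg, abs_of_nonneg hx0]; exact min_le_left _ _
      · rw [abs_of_nonpos h]; intro h3; rw [min_eq_right h3, neg_neg]
      · rw [abs_of_nonpos h, abs_neg, abs_of_nonneg hx0]; exact le_min hn1
      · have := hgn (-r) h'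
        rwa [neg_neg] at this
  obtain ⟨h, hh⟩ : ∃ h : ℝ → ℝ, h = fun r => g r + (2 / n + ε) := ⟨_, rfl⟩
  have hhs : ContDiff ℝ (⊤ : ℕ∞) h := by rw [hh]; exact hgs.add contDiff_const
  have hhd : deriv h = deriv g := by rw [hh]; funext r; simp
  have hh2 : ∀ r, 2 / (n:ℝ) ≤ h r := by
    intro r
    obtain ⟨x, -, -, -, hx⟩ := hcmp r
    have := (abs_le.1 hx).1
    have := ha0 x
    simp only [hh]; linarith
  have hhpos : ∀ r, 0 < h r := fun r => h2n.trans_le (hh2 r)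
  have hin : ∀ r : ℝ, |r| ≤ n → aFun Φ r + 2 / n ≤ h r ∧ h r ≤ aFun Φ r + 2 / n + 2 * ε := by
    intro r hr
    obtain ⟨x, -, hxr, -, hx⟩ := hcmp r
    rw [hxr hr] at hx
    have := abs_le.1 hx
    simp only [hh]; constructor <;> linarith [this.1, this.2]
  have hout : ∀ r : ℝ, 1 ≤ |r| → K⁻¹ ≤ h r := by
    intro r hr
    obtain ⟨x, -, -, hx1, hx⟩ := hcmp r
    have := abs_le.1 hx
    have h3 := hΦ.a_lower x (hx1 hr)
    simp only [hh]; linarith [this.1]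
  obtain ⟨B, hB⟩ := (isCompact_Icc (a := -(n:ℝ)) (b := n)).exists_bound_of_continuousOn
    hac.continuousOn
  have hhB : ∀ r, h r ≤ B + 2 / n + 2 * ε := by
    intro r
    obtain ⟨x, hxn, -, -, hx⟩ := hcmp r
    have h1 := abs_le.1 hx
    have h3 := hB x (abs_le.1 hxn)
    have h4 := (le_abs_self _).trans h3
    simp only [hh]; linarith [h1.2]
  have hsqs : ContDiff ℝ (⊤ : ℕ∞) (fun r => h r ^ 2) := hhs.pow 2
  let Φn : ℝ → ℝ := fun r => ∫ s in (0:ℝ)..r, h s ^ 2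
  have hder : ∀ r, HasDerivAt Φn (h r ^ 2) r := fun r =>
    (hsqs.continuous).integral_hasStrictDerivAt 0 r |>.hasDerivAt
  have hderiv : deriv Φn = fun r => h r ^ 2 := funext fun r => (hder r).deriv
  have haF : aFun Φn = h := by
    funext r
    rw [aFun, hderiv, Real.sqrt_sq (hhpos r).le]
  have hint : ∀ s r, IntervalIntegrable h volume s r :=
    fun s r => hhs.continuous.intervalIntegrable s r
  have hintA : ∀ s r, IntervalIntegrable (aFun Φ) volume s r :=
    fun s r => hac.intervalIntegrable s r
  have hAn : ∀ r s, AInt Φn r - AInt Φn s = ∫ x in s..r, h x := by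
    intro r s
    rw [AInt, AInt, haF, intervalIntegral.integral_interval_sub_left (hint _ _) (hint _ _)]
  have hA : ∀ r s, AInt Φ r - AInt Φ s = ∫ x in s..r, aFun Φ x := by
    intro r s
    rw [AInt, AInt, intervalIntegral.integral_interval_sub_left (hintA _ _) (hintA _ _)]
  have hKK : (3 * K)⁻¹ ≤ K⁻¹ := by
    apply inv_anti₀ hK0; linarith
  -- comparison of integrals inside
  have hcomp : ∀ s r : ℝ, s ≤ r → -1 ≤ s → r ≤ 1 →
      |AInt Φ r - AInt Φ s| ≤ ∫ x in s..r, h x := by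
    intro s r hsr hs hr
    rw [hA, abs_of_nonneg (intervalIntegral.integral_nonneg hsr fun x _ => ha0 x)]
    refine intervalIntegral.integral_mono_on hsr (hintA _ _) (hint _ _) fun x hx => ?_
    have := (hin x ((abs_le.2 ⟨by linarith [hx.1], by linarith [hx.2]⟩ : |x| ≤ 1).trans hn1)).1
    linarith
  have hlow : ∀ s r : ℝ, s ≤ r → (1 ≤ s ∨ r ≤ -1) → K⁻¹ * (r - s) ≤ ∫ x in s..r, h x := by
    intro s r hsr hor
    have : ∫ x in s..r, K⁻¹ = K⁻¹ * (r - s) := by simp [mul_comm]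
    rw [← this]
    refine intervalIntegral.integral_mono_on hsr (by simp) (hint _ _) fun x hx => hout x ?_
    rcases hor with h1 | h1
    · exact le_abs.2 (Or.inl (by linarith [hx.1]))
    · exact le_abs.2 (Or.inr (by linarith [hx.2]))
  have hmid : ∀ s r : ℝ, s ≤ r → -1 ≤ s → r ≤ 1 → (s = -1 ∨ r = 1) →
      K⁻¹ * (r - s) ≤ ∫ x in s..r, h x := by
    intro s r hsr hs hr hor
    refine le_trans ?_ (hcomp s r hsr hs hr)
    have := hΦ.aInt_lower_out r s (by
      rcases hor with h1 | h1
      · rw [h1]; simp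
      · rw [h1]; simp)
    rwa [abs_of_nonneg (sub_nonneg.2 hsr)] at this
  have hupper : ∀ s r : ℝ, s ≤ r → -1 ≤ s → 1 ≤ r → K⁻¹ * (r - s) ≤ ∫ x in s..r, h x := by
    intro s r hsr hs hr
    rcases le_total 1 s with h1 | h1
    · exact hlow s r hsr (Or.inl h1)
    · rw [← intervalIntegral.integral_add_adjacent_intervals (hint s 1) (hint 1 r)]
      have e1 := hmid s 1 h1 hs le_rfl (Or.inr rfl)
      have e2 := hlow 1 r hr (Or.inl le_rfl)
      linarith
  have hall : ∀ s r : ℝ, s ≤ r → (1 ≤ r ∨ s ≤ -1) → K⁻¹ * (r - s) ≤ ∫ x in s..r, h x := by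
    intro s r hsr hor
    rcases le_total (-1) s with h1 | h1
    · rcases hor with h2 | h2
      · exact hupper s r hsr h1 h2
      · have hs1 : s = -1 := le_antisymm h2 h1
        rcases le_total r 1 with h3 | h3
        · exact hmid s r hsr h1 h3 (Or.inl hs1)
        · exact hupper s r hsr h1 h3
    · rcases le_total r (-1) with h2 | h2
      · exact hlow s r hsr (Or.inr h2)
      · rw [← intervalIntegral.integral_add_adjacent_intervals (hint s (-1)) (hint (-1) r)]
        have e1 := hlow s (-1) h1 (Or.inr le_rfl)
        have e2 : K⁻¹ * (r - -1) ≤ ∫ x in (-1)..r, h x := by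
          rcases le_total r 1 with h3 | h3
          · exact hmid (-1) r h2 le_rfl h3 (Or.inl rfl)
          · exact hupper (-1) r h2 le_rfl h3
        linarith
  have hnn : ∀ s r : ℝ, s ≤ r → 0 ≤ ∫ x in s..r, h x := fun s r hsr =>
    intervalIntegral.integral_nonneg hsr fun x _ => (hhpos x).le
  refine ⟨Φn, ⟨?_, ?_, ⟨hm, by linarith, fun r => (hder r).differentiableAt, ?_, ?_, ?_, ?_, ?_,
    ?_, ?_, ?_⟩, ?_, ?_⟩⟩
  · rw [contDiff_infty_iff_deriv, hderiv]
    exact ⟨fun r => (hder r).differentiableAt, hsqs⟩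
  · intro k hk
    obtain ⟨j, rfl⟩ : ∃ j, k = j + 1 := ⟨k - 1, by omega⟩
    rw [iteratedDeriv_succ', hderiv]
    cases j with
    | zero =>
      refine ⟨(B + 2 / n + 2 * ε) ^ 2, fun r => ?_⟩
      rw [iteratedDeriv_zero, abs_of_nonneg (by positivity)]
      exact pow_le_pow_left₀ (hhpos r).le (hhB r) 2
    | succ i =>
      rw [iteratedDeriv_succ']
      refine napx_bdd i _ (contDiff_infty_iff_deriv.1 hsqs).2 ?_
      have : deriv (fun r => h r ^ 2) = fun r => (2 * h r) * deriv g r := by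
        funext r
        have h1 := ((hhs.differentiable (by simp)) r).hasDerivAt.pow 2
        have h2 : deriv (fun r => h r ^ 2) r = _ := h1.deriv
        rw [h2, hhd]; simp
      rw [this]
      exact hgc.mul_left
  · exact strictMono_of_deriv_pos fun r => by rw [hderiv]; exact pow_pos (hhpos r) 2
  · exact intervalIntegral.integral_same
  · rw [haF, abs_of_pos (hhpos 0)]
    have h1 := (hin 0 (by simp)).2
    have h2 := (le_abs_self _).trans hΦ.a_zero_le
    linarith
  · intro r _
    rw [haF]; exact (hhs.differentiable (by simp)) r
  · intro r hr
    rw [haF, hhd, hp1]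
    exact hgd r hr
  · intro r hr
    rw [haF]; exact hKK.trans (hout r hr)
  · intro r s hrs
    rw [hAn]
    refine (mul_le_mul_of_nonneg_right hKK (abs_nonneg _)).trans ?_
    rcases le_total s r with hsr | hsr
    · rw [abs_of_nonneg (sub_nonneg.2 hsr), abs_of_nonneg (hnn s r hsr)]
      refine hall s r hsr ?_
      by_contra hcon
      push Not at hcon
      have : max |r| |s| < 1 := max_lt (abs_lt.2 ⟨by linarith, by linarith⟩)
        (abs_lt.2 ⟨by linarith, by linarith⟩)
      linarith
    · rw [abs_sub_comm, intervalIntegral.integral_symm, abs_neg,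
        abs_of_nonneg (sub_nonneg.2 hsr), abs_of_nonneg (hnn r s hsr)]
      refine hall r s hsr ?_
      by_contra hcon
      push Not at hcon
      have : max |r| |s| < 1 := max_lt (abs_lt.2 ⟨by linarith, by linarith⟩)
        (abs_lt.2 ⟨by linarith, by linarith⟩)
      linarith
  · intro r s hrs
    have h1 := hΦ.aInt_lower_in r s hrs
    have hr := abs_lt.1 ((le_max_left _ _).trans_lt hrs)
    have hs := abs_lt.1 ((le_max_right _ _).trans_lt hrs)
    refine (mul_le_mul_of_nonneg_right hKK (by positivity)).trans (h1.trans ?_)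
    rw [hAn]
    rcases le_total s r with hsr | hsr
    · exact (hcomp s r hsr hs.1.le hr.2.le).trans (le_abs_self _)
    · rw [abs_sub_comm, intervalIntegral.integral_symm, abs_neg]
      exact (hcomp r s hsr hr.1.le hs.2.le).trans (le_abs_self _)
  · intro r
    rw [haF]; exact hh2 r
  · intro r hr
    rw [haF, abs_le]
    obtain ⟨h1, h2⟩ := hin r hr
    constructor <;> linarith

/-- **Proposition 4.1**: if `Φ` satisfies Assumption (Φ) with constants `m > 1` and
`K > 1`, then for every `n ≥ 1` there is a strictly increasing `Φ_n ∈ C^∞(ℝ)` with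
bounded derivatives, satisfying Assumption (Φ) (same `m`) with constant `3K`, such that
`𝔞_n = √(Φ_n′) ≥ 2/n` and `sup_{|r| ≤ n} |𝔞(r) − 𝔞_n(r)| ≤ 4/n`. -/
theorem exists_nondegenerate_approximation
    (m K : ℝ) (Φ : ℝ → ℝ) (hK : 1 < K) (hΦ : AssumptionPhi m K Φ) :
    ∀ n : ℕ, 0 < n → ∃ Φn : ℝ → ℝ, ApproxPhi m K Φ n Φn := by
  exact napx_main m K Φ hK hΦ
end
end

section
/- Let D ⊂ ℝ^d be a bounded domain with smooth boundary, let B′ ⊂ ℝ^d be an open ball such that B′ ∩ ∂D is part of the graph of a Lipschitz function, and let B be an open ball with B ⊂ B′ and dist(B, ∂B′) > 0. Then there exist a constant ε₀ > 0 and a vector η̃ ∈ ℝ^d, depending only on the local Lipschitz-graph representation of ∂D in B′, such that for every x ∈ B ∩ D̄ and every ε ∈ (0,ε₀), the translated mollifier y ↦ ϱ̃_ε(x − y − η̃) belongs to C_c^∞(D), i.e. it is smooth and compactly supported inside D. -/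
open MeasureTheory Set Filter Function
open scoped ENNReal Topology RealInnerProductSpace

noncomputable section

/-- The product mollifier `ϱ̃(x) = ∏_l ρ(x_l − 1/2)`. -/
def prodMoll {d : ℕ} (ρ : ℝ → ℝ) (x : Euc d) : ℝ := ∏ l, ρ (x l - 1 / 2)

/-- The rescaled product mollifier `ϱ̃_ε(x) = ϱ̃(x/ε)/ε^d`. -/
def prodMollEps {d : ℕ} (ρ : ℝ → ℝ) (ε : ℝ) (x : Euc d) : ℝ :=
  prodMoll ρ (ε⁻¹ • x) / ε ^ d

/-- Vectors with coordinates in `[1/2, 3/2]` have norm at most `√(4d)`. -/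
lemma norm_le_of_coord {d : ℕ} (w : Euc d) (hw : ∀ l, w l ∈ Icc (1/2:ℝ) (3/2)) :
    ‖w‖ ≤ Real.sqrt (d * 4) := by
  rw [EuclideanSpace.norm_eq]
  apply Real.sqrt_le_sqrt
  calc ∑ i, ‖w i‖ ^ 2 ≤ ∑ _i : Fin d, (4:ℝ) := by
        apply Finset.sum_le_sum
        intro i _
        obtain ⟨h1, h2⟩ := hw i
        rw [Real.norm_eq_abs, sq_abs]
        nlinarith
    _ = d * 4 := by simp

/-- Points closer than `δ` to a point of `A` at distance at least `δ` from `∂A` lie in `A`. -/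
lemma mem_of_dist_frontier {d : ℕ} (A : Set (Euc d)) (δ : ℝ) (p y : Euc d) (hp : p ∈ A)
    (h : ∀ q ∈ frontier A, δ ≤ dist p q) (hy : dist p y < δ) : y ∈ A := by
  by_contra hyA
  have hconn : IsPreconnected (segment ℝ p y) := (convex_segment p y).isPreconnected
  obtain ⟨q, hq, hqA⟩ : ∃ q ∈ segment ℝ p y, q ∈ frontier A := by
    by_contra! hno
    have hpI : p ∈ interior A := by
      by_contra hc
      exact hno p (left_mem_segment ℝ p y) ⟨subset_closure hp, hc⟩
    have hyC : y ∈ (closure A)ᶜ := fun hc =>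
      hno y (right_mem_segment ℝ p y) ⟨hc, fun hi => hyA (interior_subset hi)⟩
    obtain ⟨z, _, hz1, hz2⟩ := hconn (interior A) (closure A)ᶜ isOpen_interior
      isClosed_closure.isOpen_compl
      (fun z hz => by
        by_cases hzI : z ∈ interior A
        · exact Or.inl hzI
        · exact Or.inr fun hc => hno z hz ⟨hc, hzI⟩)
      ⟨p, left_mem_segment ℝ p y, hpI⟩ ⟨y, right_mem_segment ℝ p y, hyC⟩
    exact hz2 (subset_closure (interior_subset hz1))
  have h1 := h q hqA
  have h2 := dist_add_dist_of_mem_segment hq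
  have h3 := dist_nonneg (x := q) (y := y)
  linarith

/-- **Construction of the shifted mollifiers (Section 3)**: let `D ⊂ ℝ^d` be a bounded
domain, `B′` an open ball such that `B′ ∩ ∂D` is part of the graph of a Lipschitz
function, and `B` an open ball with `B ⊆ B′` and `dist(B, ∂B′) > 0`. Then there are
`ε₀ > 0` and a shift vector `η̃ ∈ ℝ^d` such that for all `x ∈ B ∩ D̄` and `ε ∈ (0,ε₀)`,
the translated mollifier `y ↦ ϱ̃_ε(x − y − η̃)` belongs to `C_c^∞(D)`. -/
theorem exists_shifted_mollifier
    (d : ℕ) (hd : 0 < d) (ρ : ℝ → ℝ) (hρ : IsMollifier ρ)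
    (D : Set (Euc d)) (hD_open : IsOpen D) (hD_bdd : Bornology.IsBounded D)
    (hD_conn : IsConnected D)
    (c' c : Euc d) (r' r : ℝ) (hr' : 0 < r') (hr : 0 < r)
    (hsub : Metric.ball c r ⊆ Metric.ball c' r')
    (hdist : ∃ δ : ℝ, 0 < δ ∧ ∀ p ∈ Metric.ball c r,
      ∀ q ∈ frontier (Metric.ball c' r'), δ ≤ dist p q)
    -- `B′ ∩ ∂D` is part of the graph of a Lipschitz function, with `D` below the graph
    (hLip : ∃ (L : NNReal) (e : Euc d) (f : Euc d → ℝ), ‖e‖ = 1 ∧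
      LipschitzWith L f ∧ (∀ (x : Euc d) (t : ℝ), f (x + t • e) = f x) ∧
      ∀ x ∈ Metric.ball c' r', (x ∈ D ↔ ⟪x, e⟫ < f x)) :
    ∃ ε₀ : ℝ, 0 < ε₀ ∧ ∃ η : Euc d,
      ∀ x ∈ Metric.ball c r ∩ closure D, ∀ ε ∈ Ioo (0:ℝ) ε₀,
        ContDiff ℝ (⊤ : ℕ∞) (fun y => prodMollEps ρ ε (x - y - η)) ∧
        HasCompactSupport (fun y => prodMollEps ρ ε (x - y - η)) ∧
        tsupport (fun y => prodMollEps ρ ε (x - y - η)) ⊆ D := by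
  obtain ⟨δ, hδ, hdist⟩ := hdist
  obtain ⟨L, e, f, he, hf, hfe, hD⟩ := hLip
  set C : ℝ := Real.sqrt (d * 4) with hC
  have hCpos : 0 < C := Real.sqrt_pos.2 (by positivity)
  have hL : (0:ℝ) ≤ L := L.2
  refine ⟨δ / (4 * (C * (1 + L))), by positivity, (δ / 2) • e, ?_⟩
  rintro x ⟨hxB, hxD⟩ ε ⟨hε, hε₀⟩
  rw [lt_div_iff₀ (by positivity)] at hε₀
  have hxB' := hsub hxB
  have hee : ⟪e, e⟫ = (1:ℝ) := by rw [real_inner_self_eq_norm_sq, he]; norm_num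
  -- the point `x` lies weakly below the graph
  have hxf : ⟪x, e⟫ ≤ f x := by
    have hcl : IsClosed {z : Euc d | ⟪z, e⟫ ≤ f z} :=
      isClosed_le (by fun_prop) hf.continuous
    have hx : x ∈ closure (Metric.ball c' r' ∩ D) :=
      Metric.isOpen_ball.inter_closure ⟨hxB', hxD⟩
    exact closure_minimal (fun z hz => ((hD z hz.1).1 hz.2).le) hcl hx
  set g : Euc d → ℝ := fun y => prodMollEps ρ ε (x - y - (δ / 2) • e) with hg
  have hsupp : tsupport g ⊆
      {y | ∀ l, (ε⁻¹ • (x - y - (δ / 2) • e)) l ∈ Icc (1/2:ℝ) (3/2)} := by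
    apply closure_minimal
    · intro y hy l
      have hne : ρ ((ε⁻¹ • (x - y - (δ / 2) • e)) l - 1 / 2) ≠ 0 := by
        intro h0
        apply hy
        simp only [hg, prodMollEps, prodMoll]
        rw [Finset.prod_eq_zero (Finset.mem_univ l) h0, zero_div]
      obtain ⟨h1, h2⟩ := hρ.supp hne
      constructor <;> linarith
    · simp only [ofPred_forall]
      refine isClosed_iInter fun l => ?_
      exact isClosed_Icc.preimage (by fun_prop)
  have hsub : tsupport g ⊆ D := by
    intro y hy
    have hw := norm_le_of_coord _ (hsupp hy)
    set w := ε⁻¹ • (x - y - (δ / 2) • e) with hwdef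
    have hεw : ε • w = x - y - (δ / 2) • e := by
      rw [hwdef, smul_inv_smul₀ hε.ne']
    have hyeq : y = x - ε • w + (-(δ / 2)) • e := by rw [hεw]; module
    have hnw : ‖ε • w‖ ≤ ε * C := by
      rw [norm_smul, Real.norm_of_nonneg hε.le]
      exact mul_le_mul_of_nonneg_left hw hε.le
    have hεC : 0 < ε * C := by positivity
    have hεCL : 0 ≤ ε * C * L := by positivity
    have hyB : y ∈ Metric.ball c' r' := by
      apply mem_of_dist_frontier _ δ x y hxB' (hdist x hxB)
      have h1 : x - y = ε • w + (δ / 2) • e := by rw [hεw]; module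
      have h2 := norm_add_le (ε • w) ((δ / 2) • e)
      rw [dist_eq_norm, h1]
      rw [norm_smul (δ / 2) e, he, Real.norm_of_nonneg (by positivity)] at h2
      nlinarith
    refine (hD y hyB).2 ?_
    have hfy : f y = f (x - ε • w) := by rw [hyeq, hfe]
    have hfx : f x - f (x - ε • w) ≤ L * (ε * C) := by
      have h1 := hf.dist_le_mul x (x - ε • w)
      rw [dist_eq_norm, dist_eq_norm, sub_sub_cancel] at h1
      exact (le_abs_self _).trans (h1.trans (mul_le_mul_of_nonneg_left hnw hL))
    have hin : ⟪y, e⟫ = ⟪x, e⟫ - ⟪ε • w, e⟫ - δ / 2 := by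
      rw [hyeq, inner_add_left, inner_sub_left, real_inner_smul_left e e, hee]; ring
    have hin2 : -⟪ε • w, e⟫ ≤ ε * C := by
      have h1 := abs_real_inner_le_norm (ε • w) e
      rw [he, mul_one] at h1
      exact (neg_le_abs _).trans (h1.trans hnw)
    rw [hfy, hin]
    nlinarith
  refine ⟨?_, ?_, hsub⟩
  · have hs := hρ.smooth
    simp only [hg, prodMollEps, prodMoll]
    refine ContDiff.div_const (contDiff_prod fun l _ => hs.comp ?_) _
    have hlin : ContDiff ℝ (⊤ : ℕ∞) fun y : Euc d => (ε⁻¹ • (x - y - (δ / 2) • e)) := by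
      fun_prop
    exact ((EuclideanSpace.proj (𝕜 := ℝ) l).contDiff.comp hlin).sub contDiff_const
  · exact Metric.isCompact_of_isClosed_isBounded (isClosed_tsupport g) (hD_bdd.subset hsub)
end
end
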